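/- Let k be an algebraically closed field of characteristic zero and let A be a reduced finitely generated commutative k-algebra whose Krull dimension is at most 1. Then every k-subalgebra of A is finitely generated as a k-algebra. -/

import Mathlib

open Polynomial

theorem aux_alg {k L : Type*} [Field k] [Field L] [Algebra k L]
    (htr : Algebra.trdeg k L ≤ 1) {z : L} (hz : Transcendental k z) :
    Algebra.IsAlgebraic (Algebra.adjoin k {z}) L := by
  have h1 : AlgebraicIndependent k (fun _ : Unit => z) := by
    rw [algebraicIndependent_unique_type_iff]; exact hz
  have h2 := h1.isTranscendenceBasis_of_lift_trdeg_le_of_finite (by simpa using htr)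
  have h3 := h2.isAlgebraic
  rwa [Set.range_const] at h3

theorem aux_alg' {k P L : Type*} [Field k] [Field L] [Algebra k L]
    [CommRing P] [Algebra k P] [Algebra P L] [IsScalarTower k P L] [FaithfulSMul P L]
    (htr : Algebra.trdeg k L ≤ 1) (t : P) (ht : Transcendental k (algebraMap P L t)) :
    Algebra.IsAlgebraic P L := by
  have h := aux_alg htr ht
  constructor
  intro a
  have hle : Algebra.adjoin k {algebraMap P L t} ≤ (IsScalarTower.toAlgHom k P L).range := by
    rw [Algebra.adjoin_le_iff, Set.singleton_subset_iff]
    exact ⟨t, rfl⟩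
  have h2 : IsAlgebraic (IsScalarTower.toAlgHom k P L).range a :=
    (h.1 a).ringHom_of_comp_eq (Subalgebra.inclusion hle) (RingHom.id L)
      (Subalgebra.inclusion_injective hle) rfl
  exact IsAlgebraic.of_ringHom_of_comp_eq (IsScalarTower.toAlgHom k P L).rangeRestrict
      (RingHom.id L) h2 (AlgHom.rangeRestrict_surjective _) Function.injective_id rfl

theorem aux_fin {k P L : Type*} [Field k] [Field L] [Algebra k L] [Algebra.EssFiniteType k L]
    [CommRing P] [IsDomain P] [Algebra k P] [Algebra P L] [IsScalarTower k P L]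
    [FaithfulSMul P L] [Algebra.IsAlgebraic P L]  :
    letI : Algebra (FractionRing P) L := FractionRing.liftAlgebra P L
    FiniteDimensional (FractionRing P) L := by
  let _ : Algebra (FractionRing P) L := FractionRing.liftAlgebra P L
  have : IsScalarTower P (FractionRing P) L := FractionRing.isScalarTower_liftAlgebra P L
  have : IsScalarTower k (FractionRing P) L := by
    refine IsScalarTower.of_algebraMap_eq fun x => ?_
    rw [IsScalarTower.algebraMap_apply k P L, IsScalarTower.algebraMap_apply k P (FractionRing P),
      ← IsScalarTower.algebraMap_apply P (FractionRing P) L]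
  have : Algebra.EssFiniteType (FractionRing P) L := Algebra.EssFiniteType.of_comp k _ _
  have : Algebra.IsAlgebraic (FractionRing P) L :=
    ⟨fun a => (Algebra.IsAlgebraic.isAlgebraic (R := P) a).ringHom_of_comp_eq
      (algebraMap P (FractionRing P)) (RingHom.id L) (IsFractionRing.injective P (FractionRing P))
      (IsScalarTower.algebraMap_eq P (FractionRing P) L).symm⟩
  exact Algebra.finite_of_essFiniteType_of_isAlgebraic

theorem aux_val {k L : Type*} [Field k] [CharZero k] [Field L] [Algebra k L]
    [Algebra.EssFiniteType k L] (htr : Algebra.trdeg k L ≤ 1) (y : L) (hy : Transcendental k y) :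
    {V : ValuationSubring L | (∀ c : k, algebraMap k L c ∈ V) ∧ y ∉ V}.Finite := by
  have ht : Transcendental k y⁻¹ := by
    intro h; exact hy (by simpa using h.inv)
  have hy0 : y ≠ 0 := by rintro rfl; exact hy isAlgebraic_zero
  let _ : Algebra k[X] L := (aeval (R := k) y⁻¹).toAlgebra
  have hmap : ∀ p : k[X], algebraMap k[X] L p = aeval y⁻¹ p := fun _ => rfl
  have : IsScalarTower k k[X] L := IsScalarTower.of_algebraMap_eq fun x => by
    rw [hmap]; simp
  have : FaithfulSMul k[X] L := by
    rw [faithfulSMul_iff_algebraMap_injective]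
    exact transcendental_iff_injective.mp ht
  have : Algebra.IsAlgebraic k[X] L := by
    refine aux_alg' (k := k) htr (X : k[X]) ?_
    rw [hmap, aeval_X]; exact ht
  let _ : Algebra (FractionRing k[X]) L := FractionRing.liftAlgebra k[X] L
  have : IsScalarTower k[X] (FractionRing k[X]) L := FractionRing.isScalarTower_liftAlgebra k[X] L
  have : FiniteDimensional (FractionRing k[X]) L := aux_fin (k := k)
  have : CharZero (FractionRing k[X]) := charZero_of_injective_algebraMap (R := k[X]) (IsFractionRing.injective _ _)
  have : IsDedekindDomain (integralClosure k[X] L) :=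
    integralClosure.isDedekindDomain k[X] (FractionRing k[X]) L
  have : IsFractionRing (integralClosure k[X] L) L :=
    integralClosure.isFractionRing_of_finite_extension (FractionRing k[X]) L
  set W := integralClosure k[X] L with hW
  refine ((IsDedekindDomain.HeightOneSpectrum.Support.finite W y).image
    (fun v => IsDedekindDomain.HeightOneSpectrum.valuationSubringAtPrime L v)).subset ?_
  rintro V ⟨hk, hyV⟩
  have htV : y⁻¹ ∈ V := (V.mem_or_inv_mem y).resolve_left hyV
  have hPV : ∀ p : k[X], algebraMap k[X] L p ∈ V := by
    intro p
    rw [hmap]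
    induction p using Polynomial.induction_on' with
    | add p q hp hq => rw [map_add]; exact V.add_mem _ _ hp hq
    | monomial n a =>
      rw [aeval_monomial]; exact V.mul_mem _ _ (hk a) (pow_mem htV n)
  have hWV : ∀ w : W, (w : L) ∈ V := by
    intro w
    obtain ⟨p, hp, hp0⟩ := w.2
    have : IsIntegral V (w : L) := by
      refine ⟨p.map ((algebraMap k[X] L).codRestrict V.toSubring hPV), hp.map _, ?_⟩
      rw [eval₂_map]; exact hp0
    obtain ⟨u, hu⟩ := IsIntegrallyClosed.algebraMap_eq_of_integral this
    rw [← hu]; exact u.2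
  let φ : W →+* V := (algebraMap W L).codRestrict V.toSubring hWV
  let p : Ideal W := (IsLocalRing.maximalIdeal V).comap φ
  have hp : p.IsPrime := Ideal.comap_isPrime _ _
  let t : W := algebraMap k[X] W X
  have htL : algebraMap W L t = y⁻¹ := by
    rw [← IsScalarTower.algebraMap_apply k[X] W L, hmap]; simp
  have htp : t ∈ p := by
    show φ t ∈ IsLocalRing.maximalIdeal V
    rw [IsLocalRing.mem_maximalIdeal, mem_nonunits_iff]
    intro hu
    obtain ⟨u, hu⟩ := hu.exists_right_inv
    apply hyV
    have h1 : y⁻¹ * (u : L) = 1 := by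
      have := congrArg (Subtype.val) hu
      rw [← htL]; exact this
    have h2 : (u : L) = y := by field_simp at h1; exact h1
    rw [← h2]; exact u.2
  have ht0 : t ≠ 0 := by
    intro h; rw [h, map_zero] at htL; exact inv_ne_zero hy0 htL.symm
  let v : IsDedekindDomain.HeightOneSpectrum W := ⟨p, hp, fun h => ht0 (by rw [h] at htp; exact htp)⟩
  refine ⟨v, ?_, ?_⟩
  · show 1 < v.valuation L y
    have h1 : v.valuation L (algebraMap W L t) < 1 :=
      (v.valuation_lt_one_iff_mem t).mpr htp
    rw [htL, map_inv₀] at h1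
    rw [← one_lt_inv₀] at h1
    · simpa using h1
    · simp [hy0, zero_lt_iff]
  · apply ValuationSubring.eq_of_le_of_ne_top
    · rintro x ⟨a, s, hs, rfl⟩
      refine V.mul_mem _ _ (hWV a) ?_
      have hu : IsUnit (φ s) := by
        by_contra h
        exact hs ((IsLocalRing.mem_maximalIdeal _).mpr h)
      obtain ⟨u, hu⟩ := hu.exists_right_inv
      have h1 : algebraMap W L s * (u : L) = 1 := congrArg (Subtype.val) hu
      rw [inv_eq_of_mul_eq_one_right h1]; exact u.2
    · rintro rfl; exact hyV (ValuationSubring.mem_top y)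

theorem aux_field {k L : Type*} [Field k] [IsAlgClosed k] [CharZero k] [Field L] [Algebra k L]
    [Algebra.EssFiniteType k L] (htr : Algebra.trdeg k L ≤ 1)
    (A B : Subalgebra k L) (hA : A.FG) (hBA : B ≤ A) : B.FG := by
  by_cases hB : ∀ b ∈ B, IsAlgebraic k b
  · have : B = ⊥ := by
      rw [eq_bot_iff]
      intro b hb
      have : Algebra.IsIntegral k B := ⟨fun x =>
        (isIntegral_algHom_iff B.val Subtype.val_injective).mp (hB x x.2).isIntegral⟩
      obtain ⟨c, hc⟩ := (IsAlgClosed.algebraMap_bijective_of_isIntegral (k := k) (K := B)).2 ⟨b, hb⟩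
      exact ⟨c, congrArg Subtype.val hc⟩
    rw [this]; exact Subalgebra.fg_bot
  push Not at hB
  obtain ⟨z, hzB, hz⟩ := hB
  obtain ⟨s, rfl⟩ := hA
  have hint : ∀ (V : ValuationSubring L), (∀ c : k, algebraMap k L c ∈ V) → ∀ x : L,
      IsAlgebraic k x → x ∈ V := by
    intro V hk x hx
    obtain ⟨p, hp, hp0⟩ := hx.isIntegral
    have : IsIntegral V x := by
      refine ⟨p.map ((algebraMap k L).codRestrict V.toSubring hk), hp.map _, ?_⟩
      rw [eval₂_map]; exact hp0
    obtain ⟨u, hu⟩ := IsIntegrallyClosed.algebraMap_eq_of_integral this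
    rw [← hu]; exact u.2
  have hS : {V : ValuationSubring L | (∀ c : k, algebraMap k L c ∈ V) ∧ ∃ b ∈ B, b ∉ V}.Finite := by
    refine Set.Finite.subset (s := ⋃ y ∈ {y ∈ (s : Set L) | Transcendental k y},
      {V : ValuationSubring L | (∀ c : k, algebraMap k L c ∈ V) ∧ y ∉ V}) ?_ ?_
    · exact (s.finite_toSet.subset (Set.sep_subset _ _)).biUnion
        fun y hy => aux_val htr y hy.2
    · rintro V ⟨hk, b, hb, hbV⟩
      by_contra hcon
      simp only [Set.mem_iUnion, not_exists] at hcon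
      let V' : Subalgebra k L := { V.toSubring with algebraMap_mem' := hk }
      have hle : Algebra.adjoin k (s : Set L) ≤ V' := by
        rw [Algebra.adjoin_le_iff]
        intro y hy
        by_contra hyV
        by_cases hya : IsAlgebraic k y
        · exact hyV (hint V hk y hya)
        · exact hcon y ⟨hy, hya⟩ ⟨hk, hyV⟩
      exact hbV (hle (hBA hb))
  have hch : ∀ V : ValuationSubring L, ∃ b ∈ B, (∃ b' ∈ B, b' ∉ V) → b ∉ V := by
    intro V
    by_cases h : ∃ b' ∈ B, b' ∉ V
    · obtain ⟨b, hb, hbV⟩ := h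
      exact ⟨b, hb, fun _ => hbV⟩
    · exact ⟨z, hzB, fun h' => absurd h' h⟩
  choose β hβB hβ using hch
  set T : Set L := insert z (β '' {V : ValuationSubring L | (∀ c : k, algebraMap k L c ∈ V) ∧ ∃ b ∈ B, b ∉ V}) with hT
  have hTf : T.Finite := (hS.image β).insert z
  set B₀ : Subalgebra k L := Algebra.adjoin k T with hB₀
  have hB₀B : B₀ ≤ B := by
    rw [hB₀, Algebra.adjoin_le_iff, hT]
    rintro x (rfl | ⟨V, -, rfl⟩)
    · exact hzB
    · exact hβB V
  have hBint : ∀ b ∈ B, IsIntegral B₀ b := by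
    intro b hb
    have h1 : b ∈ (integralClosure (Subring.closure (B₀ : Set L)) L).toSubring := by
      rw [← iInf_valuationSubring_superset, Subring.mem_iInf]
      rintro ⟨V, hV⟩
      by_contra hbV
      have hk : ∀ c : k, algebraMap k L c ∈ V := fun c => hV (B₀.algebraMap_mem c)
      refine hβ V ⟨b, hb, hbV⟩ (hV ?_)
      exact Algebra.subset_adjoin (Set.mem_insert_of_mem _ ⟨V, ⟨hk, b, hb, hbV⟩, rfl⟩)
    obtain ⟨p, hp, hp0⟩ := h1
    have hle : Subring.closure (B₀ : Set L) ≤ B₀.toSubring := Subring.closure_le.mpr subset_rfl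
    refine ⟨p.map (Subring.inclusion hle), hp.map _, ?_⟩
    rw [eval₂_map]; exact hp0
  have : Algebra.FiniteType k B₀ :=
    B₀.fg_iff_finiteType.mp (Subalgebra.fg_def.mpr ⟨T, hTf, rfl⟩)
  obtain ⟨n, g, ginj, gint⟩ := exists_integral_inj_algHom_of_fg k B₀
  set P := MvPolynomial (Fin n) k
  let _ : Algebra P B₀ := g.toRingHom.toAlgebra
  have hPB : Algebra.IsIntegral P B₀ := ⟨gint⟩
  let _ : Algebra P L := (B₀.val.comp g).toRingHom.toAlgebra
  have : IsScalarTower P B₀ L := IsScalarTower.of_algebraMap_eq fun _ => rfl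
  have : IsScalarTower k P L := IsScalarTower.of_algebraMap_eq fun x => 
    ((B₀.val.comp g).commutes x).symm
  have : FaithfulSMul P L := by
    rw [faithfulSMul_iff_algebraMap_injective]
    exact Subtype.val_injective.comp ginj
  have : FaithfulSMul P B₀ := by
    rw [faithfulSMul_iff_algebraMap_injective]
    exact ginj
  have : Algebra.IsAlgebraic B₀ L :=
    aux_alg' (k := k) htr (⟨z, Algebra.subset_adjoin (Set.mem_insert _ _)⟩ : B₀) hz
  have : Algebra.IsAlgebraic P L := Algebra.IsAlgebraic.trans P B₀ L
  let _ : Algebra (FractionRing P) L := FractionRing.liftAlgebra P L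
  have : IsScalarTower P (FractionRing P) L := FractionRing.isScalarTower_liftAlgebra P L
  have : FiniteDimensional (FractionRing P) L := aux_fin (k := k)
  have : CharZero (FractionRing P) :=
    charZero_of_injective_algebraMap (R := P) (IsFractionRing.injective _ _)
  have hN : IsNoetherian P (integralClosure P L) :=
    IsIntegralClosure.isNoetherian P (FractionRing P) L _
  let B' : Subalgebra P L := { B with algebraMap_mem' := fun p => hB₀B (g p).2 }
  have hle : B' ≤ integralClosure P L := fun b hb => isIntegral_trans (A := B₀) b (hBint b hb)
  have : Module.Finite P B' :=
    Module.Finite.of_injective (Subalgebra.inclusion hle).toLinearMap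
      (Subalgebra.inclusion_injective hle)
  have h1 : Algebra.FiniteType k B' := Algebra.FiniteType.trans (S := P) inferInstance inferInstance
  have h2 : Algebra.FiniteType k B := h1
  exact B.fg_iff_finiteType.mpr h2

theorem aux_trdeg {k A : Type*} [Field k] [CommRing A] [IsDomain A] [Algebra k A]
    [Algebra.FiniteType k A] (hdim : ringKrullDim A ≤ 1) :
    Algebra.trdeg k (FractionRing A) ≤ 1 := by
  obtain ⟨n, g, ginj, gint⟩ := exists_integral_inj_algHom_of_fg k A
  let _ : Algebra (MvPolynomial (Fin n) k) A := g.toRingHom.toAlgebra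
  have : Algebra.IsIntegral (MvPolynomial (Fin n) k) A := ⟨gint⟩
  have : IsScalarTower k (MvPolynomial (Fin n) k) A := IsScalarTower.of_algebraMap_eq fun x => 
    (g.commutes x).symm
  have : FaithfulSMul (MvPolynomial (Fin n) k) A := by
    rw [faithfulSMul_iff_algebraMap_injective]
    exact ginj
  have hd : ringKrullDim (MvPolynomial (Fin n) k) ≤ ringKrullDim A := by
    refine iSup_le fun l => ?_
    obtain ⟨⟨P, hP, hPl⟩⟩ := Ideal.nonempty_primesOver (S := A) (RelSeries.head l).asIdeal
    obtain ⟨L, hL, -, -⟩ := Ideal.exists_ltSeries_of_hasGoingUp (S := A) l P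
    rw [← hL]
    exact le_iSup (fun L : LTSeries (PrimeSpectrum A) => (L.length : WithBot ℕ∞)) L
  rw [MvPolynomial.ringKrullDim_of_isNoetherianRing, ringKrullDim_eq_zero_of_field] at hd
  have hn : n ≤ 1 := by
    have := hd.trans hdim
    simp at this
    exact_mod_cast this
  have : Algebra.IsAlgebraic A (FractionRing A) :=
    IsLocalization.isAlgebraic (FractionRing A) (nonZeroDivisors A)
  have : Algebra.IsAlgebraic (MvPolynomial (Fin n) k) (FractionRing A) :=
    Algebra.IsAlgebraic.trans _ A _
  have : FaithfulSMul (MvPolynomial (Fin n) k) (FractionRing A) := by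
    rw [faithfulSMul_iff_algebraMap_injective,
      IsScalarTower.algebraMap_eq (MvPolynomial (Fin n) k) A (FractionRing A)]
    exact (IsFractionRing.injective A (FractionRing A)).comp ginj
  have h1 := lift_trdeg_add_eq k (MvPolynomial (Fin n) k) (FractionRing A)
  rw [trdeg_eq_zero_iff.mpr ‹Algebra.IsAlgebraic (MvPolynomial (Fin n) k) (FractionRing A)›,
    MvPolynomial.trdeg_of_isDomain] at h1
  rw [← Cardinal.lift_le_one_iff, ← h1]
  simpa using hn

theorem aux_domain {k A : Type*} [Field k] [IsAlgClosed k] [CharZero k] [CommRing A] [IsDomain A]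
    [Algebra k A] [Algebra.FiniteType k A] (hdim : ringKrullDim A ≤ 1) (B : Subalgebra k A) :
    B.FG := by
  have htr := aux_trdeg (k := k) hdim
  have : Algebra.EssFiniteType k (FractionRing A) := Algebra.EssFiniteType.comp k A _
  let f : A →ₐ[k] FractionRing A := IsScalarTower.toAlgHom k A _
  have hf : Function.Injective f := IsFractionRing.injective A _
  refine Subalgebra.fg_of_fg_map B f hf (aux_field htr (Subalgebra.map f ⊤) _ ?_ ?_)
  · exact Subalgebra.FG.map _ Algebra.FiniteType.out
  · exact Subalgebra.map_mono le_top

theorem aux_inf {k B : Type*} [Field k] [CommRing B] [Algebra k B] (I J : Ideal B)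
    (hI : Algebra.FiniteType k (B ⧸ I)) (hJ : Algebra.FiniteType k (B ⧸ J)) :
    Algebra.FiniteType k (B ⧸ (I ⊓ J)) := by
  let f : (B ⧸ (I ⊓ J)) →ₐ[B] (B ⧸ I) × (B ⧸ J) :=
    (Ideal.Quotient.factorₐ B inf_le_left).prod (Ideal.Quotient.factorₐ B inf_le_right)
  let _ : Algebra (B ⧸ (I ⊓ J)) ((B ⧸ I) × (B ⧸ J)) := f.toRingHom.toAlgebra
  have t1 : IsScalarTower B (B ⧸ (I ⊓ J)) ((B ⧸ I) × (B ⧸ J)) :=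
    IsScalarTower.of_algebraMap_eq fun x => (f.commutes x).symm
  have t2 : IsScalarTower k (B ⧸ (I ⊓ J)) ((B ⧸ I) × (B ⧸ J)) := 
    IsScalarTower.of_algebraMap_eq fun x => rfl
  have h1 : Module.Finite B ((B ⧸ I) × (B ⧸ J)) := inferInstance
  have h2 : Module.Finite (B ⧸ (I ⊓ J)) ((B ⧸ I) × (B ⧸ J)) :=
    Module.Finite.of_restrictScalars_finite B _ _
  have h3 : Algebra.FiniteType k ((B ⧸ I) × (B ⧸ J)) := inferInstance
  refine ⟨fg_of_fg_of_fg k (B ⧸ (I ⊓ J)) ((B ⧸ I) × (B ⧸ J)) h3.out h2.fg_top ?_⟩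
  rw [injective_iff_map_eq_zero]
  intro x hx
  obtain ⟨b, rfl⟩ := Ideal.Quotient.mk_surjective x
  have e1 : (Ideal.Quotient.mk I b) = 0 := congrArg Prod.fst hx
  have e2 : (Ideal.Quotient.mk J b) = 0 := congrArg Prod.snd hx
  rw [Ideal.Quotient.eq_zero_iff_mem] at e1 e2 ⊢
  exact ⟨e1, e2⟩

/-- Let `k` be an algebraically closed field of characteristic zero and `A` a reduced finitely
generated commutative `k`-algebra of Krull dimension at most `1`. Then every `k`-subalgebra of
`A` is finitely generated as a `k`-algebra. -/
theorem stmt_3 {k : Type*} [Field k] [IsAlgClosed k] [CharZero k]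
    {A : Type*} [CommRing A] [Algebra k A] [Algebra.FiniteType k A] [IsReduced A]
    (hdim : ringKrullDim A ≤ 1) :
    ∀ B : Subalgebra k A, B.FG := by
  intro B
  have hNoeth : IsNoetherianRing A := Algebra.FiniteType.isNoetherianRing k A
  have hfin : (minimalPrimes A).Finite := minimalPrimes.finite_of_isNoetherianRing A
  have key : ∀ p ∈ minimalPrimes A, Algebra.FiniteType k (B ⧸ (p.comap B.val)) := by
    intro p hp
    have : p.IsPrime := hp.1.1
    have hd : ringKrullDim (A ⧸ p) ≤ 1 := (ringKrullDim_quotient_le p).trans hdim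
    let f : B →ₐ[k] A ⧸ p := (Ideal.Quotient.mkₐ k p).comp B.val
    have hFG := f.range.fg_iff_finiteType.mp (aux_domain hd f.range)
    have hker : RingHom.ker f = p.comap B.val := by
      ext x
      exact Ideal.Quotient.eq_zero_iff_mem
    rw [← hker]
    exact hFG.equiv (Ideal.quotientKerEquivRange f).symm
  have key2 : ∀ s : Finset (Ideal A), (∀ p ∈ s, p ∈ minimalPrimes A) →
      Algebra.FiniteType k (B ⧸ ((s.inf id).comap B.val)) := by
    classical
    intro s
    induction s using Finset.induction_on with
    | empty =>
      intro _
      rw [Finset.inf_empty, Ideal.comap_top]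
      have : Subsingleton (B ⧸ (⊤ : Ideal B)) := Ideal.Quotient.subsingleton_iff.mpr rfl
      infer_instance
    | insert a s _ ih =>
      intro h
      rw [Finset.inf_insert, Ideal.comap_inf]
      exact aux_inf _ _ (key a (h a (by simp))) (ih fun p hp => h p (by simp [hp]))
  have h3 := key2 hfin.toFinset (by simp)
  have h4 : (hfin.toFinset.inf id) = (⊥ : Ideal A) := by
    have := Ideal.sInf_minimalPrimes (I := (⊥ : Ideal A))
    rw [Finset.inf_id_eq_sInf, hfin.coe_toFinset]
    rw [← Ideal.zero_eq_bot, ← nilradical, nilradical_eq_zero] at this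
    exact this
  rw [h4] at h3
  have h5 : (⊥ : Ideal A).comap B.val = ⊥ := by
    ext x; simp
  rw [h5] at h3
  exact B.fg_iff_finiteType.mpr (h3.equiv (AlgEquiv.quotientBot k B))
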